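/- arXiv:2605.02115 — 2 statements merged into one kernel-verified Lean document; each statement's English description precedes it below -/
import Mathlib

section
/- Let C be a small category with a Grothendieck topology J, let X = Sheaf J (Type u) be the associated Grothendieck topos, and let D be any category. A functor F : Xᵒᵖ ⥤ D is a sheaf for the canonical topology on X (in the sense of Presheaf.IsSheaf) if and only if F preserves all limits of u-small shape. -/
/-!
Statement 8: For a Grothendieck topos `X = Sheaf J (Type u)` and any category `D`, a
functor `F : Xᵒᵖ ⥤ D` is a sheaf for the canonical topology on `X` (in the sense of
`Presheaf.IsSheaf`) if and only if `F` preserves all limits of `u`-small shape.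
-/

open CategoryTheory Limits

universe w v u

namespace CategoryTheory.Sheaf

open Opposite

variable {C : Type u} [SmallCategory C] {J : GrothendieckTopology C}

variable (J) in
/-- The functor sending an object `c` to the sheaf associated to the presheaf it represents. -/
noncomputable def representedSheaf : C ⥤ Sheaf J (Type u) :=
  yoneda ⋙ presheafToSheaf J (Type u)

/-- The morphism `h_c^# ⟶ X` classifying a section of `X` over `c`. -/
noncomputable def ofSection {X : Sheaf J (Type u)} {c : C} (x : X.obj.obj (op c)) :
    (representedSheaf J).obj c ⟶ X :=
  ((sheafificationAdjunction J (Type u)).homEquiv _ _).symm (yonedaEquiv.symm x)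

lemma ofSection_comp {X Y : Sheaf J (Type u)} {c : C} (x : X.obj.obj (op c)) (f : X ⟶ Y) :
    ofSection x ≫ f = ofSection (f.hom.app (op c) x) :=
  ((sheafificationAdjunction J (Type u)).homEquiv_naturality_right_symm
    (yonedaEquiv.symm x) f).symm.trans
      (congr_arg ((sheafificationAdjunction J (Type u)).homEquiv _ _).symm
        (yonedaEquiv_symm_naturality_right _ f.hom x))

lemma map_comp_ofSection {X : Sheaf J (Type u)} {c d : C} (g : d ⟶ c) (x : X.obj.obj (op c)) :
    (representedSheaf J).map g ≫ ofSection x = ofSection (X.obj.map g.op x) :=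
  ((sheafificationAdjunction J (Type u)).homEquiv_naturality_left_symm
    (yoneda.map g) (yonedaEquiv.symm x)).symm.trans
      (congr_arg ((sheafificationAdjunction J (Type u)).homEquiv _ _).symm
        (yonedaEquiv_symm_naturality_left g X.obj x))

lemma ofSection_bijective (X : Sheaf J (Type u)) (c : C) :
    Function.Bijective (ofSection : X.obj.obj (op c) → ((representedSheaf J).obj c ⟶ X)) :=
  (yonedaEquiv.symm.trans ((sheafificationAdjunction J (Type u)).homEquiv _ _).symm).bijective

/-- The sections of `X` whose classifying morphism belongs to a sieve on `X`. -/
noncomputable def sectionsOfSieve {X : Sheaf J (Type u)} (S : Sieve X) : Subfunctor X.obj where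
  obj c := {x | S.arrows (ofSection (c := c.unop) x)}
  map i x hx := by
    have := S.downward_closed hx ((representedSheaf J).map i.unop)
    rwa [map_comp_ofSection] at this

/-- The diagram of represented sheaves indexed by the elements of a subpresheaf `U` of `X`. -/
noncomputable abbrev elementsDiagram {X : Sheaf J (Type u)} (U : Subfunctor X.obj) :
    U.toFunctor.Elementsᵒᵖ ⥤ Sheaf J (Type u) :=
  (CategoryOfElements.π U.toFunctor).leftOp ⋙ representedSheaf J

/-- The cocone with point `X` over the diagram of represented sheaves indexed by the elements of
a subpresheaf of `X`. -/
noncomputable def elementsCocone {X : Sheaf J (Type u)} (U : Subfunctor X.obj) :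
    Cocone (elementsDiagram U) where
  pt := X
  ι :=
    { app p := ofSection (c := p.unop.1.unop) p.unop.2.1
      naturality p q f := by
        refine (map_comp_ofSection f.unop.1.unop _).trans ?_
        have := congr_arg Subtype.val f.unop.2
        exact (congr_arg ofSection this).trans (Category.comp_id _).symm }

/-- The section corresponding to a morphism from a represented sheaf. -/
noncomputable def toSection {X : Sheaf J (Type u)} {c : C}
    (f : (representedSheaf J).obj c ⟶ X) : X.obj.obj (op c) :=
  (Equiv.ofBijective _ (ofSection_bijective X c)).symm f

@[simp]
lemma ofSection_toSection {X : Sheaf J (Type u)} {c : C}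
    (f : (representedSheaf J).obj c ⟶ X) : ofSection (toSection f) = f :=
  (Equiv.ofBijective _ (ofSection_bijective X c)).apply_symm_apply f

/-- A sheaf is the colimit of the represented sheaves indexed by the elements of a dense
subpresheaf. -/
lemma nonempty_isColimit_elementsCocone {X : Sheaf J (Type u)} (U : Subfunctor X.obj)
    [Presheaf.IsLocallySurjective J U.ι] : Nonempty (IsColimit (elementsCocone U)) := by
  have hW : J.W U.ι := J.W_of_isLocallyBijective _
  have h (s : Cocone (elementsDiagram U)) :
      ∃! l : X ⟶ s.pt, ∀ p, (elementsCocone U).ι.app p ≫ l = s.ι.app p := by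
    let α : U.toFunctor ⟶ s.pt.obj :=
      { app c := ↾fun x ↦ toSection (c := c.unop) (s.ι.app (op ⟨c, x⟩))
        naturality c d f := by
          ext x
          apply (ofSection_bijective s.pt d.unop).1
          let φ := CategoryOfElements.homMk (F := U.toFunctor) ⟨c, x⟩ ⟨d, U.toFunctor.map f x⟩ f rfl
          have := s.w φ.op
          refine (ofSection_toSection _).trans (this.symm.trans ?_)
          refine Eq.trans ?_ (map_comp_ofSection f.unop _)
          exact congr_arg (_ ≫ ·) (ofSection_toSection _).symm }
    have key (l : X ⟶ s.pt) :
        (∀ p, (elementsCocone U).ι.app p ≫ l = s.ι.app p) ↔ U.ι ≫ l.hom = α := by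
      constructor
      · intro hl
        ext c x
        apply (ofSection_bijective s.pt c.unop).1
        refine (ofSection_comp (c := c.unop) x.1 l).symm.trans ?_
        exact (hl (op ⟨c, x⟩)).trans (ofSection_toSection _).symm
      · intro hl p
        refine (ofSection_comp (c := p.unop.1.unop) p.unop.2.1 l).trans ?_
        have := ConcreteCategory.congr_hom (congr_app hl p.unop.1) p.unop.2
        exact (congr_arg ofSection this).trans (ofSection_toSection _)
    obtain ⟨l, hl, hl'⟩ := (hW s.pt.obj s.pt.property).existsUnique α
    refine ⟨⟨l⟩, (key _).2 hl, fun l' h' ↦ ?_⟩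
    ext1
    exact hl' _ ((key l').1 h')
  exact ⟨IsColimit.ofExistsUnique h⟩

/-- A sieve on a sheaf `X` is dense if every section of `X` locally belongs to it. -/
abbrev IsDenseSieve {X : Sheaf J (Type u)} (S : Sieve X) : Prop :=
  Presheaf.IsLocallySurjective J (sectionsOfSieve S).ι

lemma isDenseSieve_iff {X : Sheaf J (Type u)} (S : Sieve X) :
    IsDenseSieve S ↔ ∀ (c : C) (x : X.obj.obj (op c)),
      (S.pullback (ofSection x)).functorPullback (representedSheaf J) ∈ J c := by
  have (c : C) (x : X.obj.obj (op c)) :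
      Presheaf.imageSieve (sectionsOfSieve S).ι x =
        (S.pullback (ofSection x)).functorPullback (representedSheaf J) := by
    ext d g
    change (∃ t, _) ↔ S.arrows ((representedSheaf J).map g ≫ ofSection x)
    rw [map_comp_ofSection]
    constructor
    · rintro ⟨t, ht⟩
      rw [← ht]
      exact t.2
    · exact fun h ↦ ⟨⟨_, h⟩, rfl⟩
  exact ⟨fun h c x ↦ this c x ▸ h.imageSieve_mem x, fun h ↦ ⟨fun x ↦ this _ x ▸ h _ x⟩⟩

lemma IsDenseSieve.of_forall_ofSection {X : Sheaf J (Type u)} {S : Sieve X}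
    (h : ∀ (c : C) (x : X.obj.obj (op c)), S.arrows (ofSection x)) : IsDenseSieve S := by
  rw [isDenseSieve_iff]
  intro c x
  rw [(Sieve.mem_iff_pullback_eq_top _).1 (h c x), Sieve.functorPullback_top]
  exact J.top_mem c

lemma IsDenseSieve.pullback {X Y : Sheaf J (Type u)} {S : Sieve X} (h : IsDenseSieve S)
    (f : Y ⟶ X) : IsDenseSieve (S.pullback f) := by
  rw [isDenseSieve_iff] at h ⊢
  intro c y
  rw [← Sieve.pullback_comp, ofSection_comp]
  exact h c _

lemma hom_ext_of_forall_ofSection {X Y : Sheaf J (Type u)} {f g : X ⟶ Y}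
    (h : ∀ (c : C) (x : X.obj.obj (op c)), ofSection x ≫ f = ofSection x ≫ g) : f = g := by
  ext c x
  apply (ofSection_bijective Y c.unop).1
  exact (ofSection_comp (c := c.unop) x f).symm.trans
    ((h _ _).trans (ofSection_comp (c := c.unop) x g))

/-- A jointly epimorphic sieve on a sheaf is dense. -/
lemma IsDenseSieve.of_jointly_epi {X : Sheaf J (Type u)} {S : Sieve X}
    (hS : ∀ ⦃W : Sheaf J (Type u)⦄ (a b : X ⟶ W),
      (∀ ⦃Y : Sheaf J (Type u)⦄ (f : Y ⟶ X), S.arrows f → f ≫ a = f ≫ b) → a = b) :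
    IsDenseSieve S := by
  let U := sectionsOfSieve S
  let adj := sheafificationAdjunction J (Type u)
  let m : (presheafToSheaf J (Type u)).obj U.toFunctor ⟶ X := (adj.homEquiv _ _).symm U.ι
  have fac : toSheafify J U.toFunctor ≫ m.hom = U.ι :=
    (adj.homEquiv_unit ..).symm.trans ((adj.homEquiv _ _).apply_symm_apply U.ι)
  have : Epi m := by
    refine ⟨fun {W} a b hab ↦ hS a b fun Y f hf ↦ hom_ext_of_forall_ofSection fun c y ↦ ?_⟩
    have h : U.ι ≫ a.hom = U.ι ≫ b.hom := by
      rw [← fac, Category.assoc, Category.assoc]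
      exact congr_arg (toSheafify J U.toFunctor ≫ ·) (congr_arg (·.hom) hab)
    have hy : S.arrows (ofSection (f.hom.app (op c) y)) := by
      rw [← ofSection_comp]
      exact S.downward_closed hf _
    rw [← Category.assoc, ← Category.assoc, ofSection_comp, ofSection_comp, ofSection_comp]
    exact congr_arg ofSection
      (ConcreteCategory.congr_hom (congr_app h (op c)) (⟨_, hy⟩ : U.obj (op c)))
  have : Presheaf.IsLocallySurjective J m.hom := (isLocallySurjective_iff_epi m).2 this
  exact (Presheaf.isLocallySurjective_iff_of_fac J fac).2 this

section

variable {G : (Sheaf J (Type u))ᵒᵖ ⥤ Type w}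

lemma existsUnique_of_preservesLimits [PreservesLimitsOfSize.{u, u} G]
    {X : Sheaf J (Type u)} (U : Subfunctor X.obj) [Presheaf.IsLocallySurjective J U.ι]
    (t : ∀ (c : C), U.obj (op c) → G.obj (op ((representedSheaf J).obj c)))
    (ht : ∀ ⦃c d : C⦄ (g : d ⟶ c) (x : U.obj (op c)),
      G.map ((representedSheaf J).map g).op (t c x) = t d (U.toFunctor.map g.op x)) :
    ∃! s : G.obj (op X), ∀ (c : C) (x : U.obj (op c)), G.map (ofSection x.1).op s = t c x := by
  obtain ⟨h⟩ := nonempty_isColimit_elementsCocone U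
  have := (Types.isLimit_iff _).1 ⟨isLimitOfPreserves G h.op⟩
    (fun p ↦ t p.unop.unop.1.unop p.unop.unop.2) (fun {p q} f ↦ by
      refine (ht f.unop.unop.1.unop p.unop.unop.2).trans ?_
      exact congr_arg _ f.unop.unop.2)
  obtain ⟨s, hs, hs'⟩ := this
  exact ⟨s, fun c x ↦ hs (op (op ⟨op c, x⟩)), fun s' h' ↦ hs' s' fun p ↦ h' _ _⟩

lemma ext_of_preservesLimits [PreservesLimitsOfSize.{u, u} G]
    {X : Sheaf J (Type u)} {s t : G.obj (op X)}
    (h : ∀ (c : C) (x : X.obj.obj (op c)),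
      G.map (ofSection x).op s = G.map (ofSection x).op t) : s = t := by
  have : IsDenseSieve (⊤ : Sieve X) := .of_forall_ofSection fun _ _ ↦ trivial
  refine (existsUnique_of_preservesLimits (G := G) (sectionsOfSieve (⊤ : Sieve X))
    (fun c x ↦ G.map (ofSection x.1).op t) fun c d g x ↦ ?_).unique
      (fun c x ↦ h c x.1) (fun _ _ ↦ rfl)
  rw [← Functor.map_comp_apply, ← op_comp, map_comp_ofSection]
  rfl

lemma IsDenseSieve.isSheafFor [PreservesLimitsOfSize.{u, u} G]
    {X : Sheaf J (Type u)} {S : Sieve X} (hS : IsDenseSieve S) :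
    Presieve.IsSheafFor G S.arrows := by
  intro x hx
  rw [Presieve.compatible_iff_sieveCompatible] at hx
  have x_congr {Y : Sheaf J (Type u)} {f g : Y ⟶ X} (h : f = g) (hf : S.arrows f) :
      x f hf = x g (h ▸ hf) := by
    subst h
    rfl
  obtain ⟨s, hs, hs'⟩ := existsUnique_of_preservesLimits (G := G) (sectionsOfSieve S)
    (fun c y ↦ x (ofSection y.1) y.2) fun c d g y ↦
      (hx (ofSection y.1) ((representedSheaf J).map g) y.2).symm.trans
        (x_congr (map_comp_ofSection g y.1) _)
  refine ⟨s, fun Y f hf ↦ ext_of_preservesLimits fun c y ↦ ?_,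
    fun s' h' ↦ hs' s' fun c y ↦ h' _ y.2⟩
  have hy : S.arrows (ofSection (f.hom.app (op c) y)) := by
    rw [← ofSection_comp]
    exact S.downward_closed hf _
  rw [← Functor.map_comp_apply, ← op_comp, ← hx]
  exact (congr_arg (fun g ↦ G.map g.op s) (ofSection_comp y f)).trans
    ((hs c ⟨_, hy⟩).trans (x_congr (ofSection_comp y f).symm hy))

end

lemma mem_canonicalTopology_iff_isDenseSieve {X : Sheaf J (Type u)} (S : Sieve X) :
    S ∈ canonicalTopology (Sheaf J (Type u)) X ↔ IsDenseSieve S := by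
  refine ⟨fun hS ↦ .of_jointly_epi fun W a b h ↦ ?_, fun hS ↦ ?_⟩
  · exact (isSheaf_yoneda_obj W S hS).isSeparatedFor.ext h
  · refine mem_finestTopology_of_forall_isSheafFor ?_
    rintro _ ⟨W, rfl⟩ Y f
    exact (hS.pullback f).isSheafFor

lemma isSheaf_canonicalTopology_of_preservesLimits (G : (Sheaf J (Type u))ᵒᵖ ⥤ Type w)
    [PreservesLimitsOfSize.{u, u} G] :
    Presieve.IsSheaf (canonicalTopology (Sheaf J (Type u))) G :=
  fun _ S hS ↦ ((mem_canonicalTopology_iff_isDenseSieve S).1 hS).isSheafFor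

section

variable {G : (Sheaf J (Type u))ᵒᵖ ⥤ Type w} {I : Type u} [SmallCategory I]
  {K : I ⥤ (Sheaf J (Type u))ᵒᵖ}

/-- The quotient of the disjoint union of the presheaves underlying a diagram of sheaves `K` which
identifies two sections when a given family of elements of `G` has the same restriction
along them. -/
noncomputable def quotientPresheaf (s : ∀ i, G.obj (K.obj i)) : Cᵒᵖ ⥤ Type u where
  obj c := _root_.Quotient (Setoid.ker fun p : Σ i, (K.obj i).unop.obj.obj (op c.unop) ↦
    G.map (ofSection p.2).op (s p.1))
  map f := ↾_root_.Quotient.map (fun p ↦ ⟨p.1, (K.obj p.1).unop.obj.map f p.2⟩) fun p q h ↦ by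
    replace h : G.map (ofSection p.2).op (s p.1) = G.map (ofSection q.2).op (s q.1) := h
    have := congr_arg (G.map ((representedSheaf J).map f.unop).op) h
    simp only [← Functor.map_comp_apply, ← op_comp, map_comp_ofSection] at this
    exact this
  map_id _ := by
    ext ⟨p⟩
    exact congr_arg (_root_.Quotient.mk _)
      (Sigma.ext rfl (heq_of_eq (by simp)))
  map_comp f g := by
    ext ⟨p⟩
    exact congr_arg (_root_.Quotient.mk _)
      (Sigma.ext rfl (heq_of_eq (by simp)))

/-- The canonical map from a term of the diagram to the quotient presheaf. -/
noncomputable def toQuotientPresheaf (s : ∀ i, G.obj (K.obj i)) (i : I) :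
    (K.obj i).unop.obj ⟶ quotientPresheaf s where
  app _ := ↾fun x ↦ _root_.Quotient.mk _ ⟨i, x⟩
  naturality _ _ _ := rfl

lemma toQuotientPresheaf_eq_iff (s : ∀ i, G.obj (K.obj i)) {i j : I} {c : C}
    (x : (K.obj i).unop.obj.obj (op c)) (y : (K.obj j).unop.obj.obj (op c)) :
    (toQuotientPresheaf s i).app (op c) x = (toQuotientPresheaf s j).app (op c) y ↔
      G.map (ofSection x).op (s i) = G.map (ofSection y).op (s j) :=
  _root_.Quotient.eq

/-- The canonical map from a term of the diagram to the sheaf associated to the quotient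
presheaf. -/
noncomputable def toQuotientSheaf (s : ∀ i, G.obj (K.obj i)) (i : I) :
    (K.obj i).unop ⟶ (presheafToSheaf J (Type u)).obj (quotientPresheaf s) where
  hom := toQuotientPresheaf s i ≫ toSheafify J (quotientPresheaf s)

/-- The cone over `K` whose point is the sheaf associated to the quotient presheaf of a
compatible family. -/
noncomputable def quotientCone (s : ∀ i, G.obj (K.obj i)) (hs : s ∈ (K ⋙ G).sections) :
    Cone K where
  pt := op ((presheafToSheaf J (Type u)).obj (quotientPresheaf s))
  π :=
    { app i := (toQuotientSheaf s i).op
      naturality i j f := by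
        apply Quiver.Hom.unop_inj
        ext c x
        refine congr_arg ((toSheafify J (quotientPresheaf s)).app c)
          ((toQuotientPresheaf_eq_iff s (c := c.unop) x ((K.map f).unop.hom.app c x)).2 ?_)
        refine Eq.trans ?_ (congr_arg (fun g ↦ G.map g.op (s i))
          (ofSection_comp (c := c.unop) x (K.map f).unop))
        rw [← hs f]
        exact (Functor.map_comp_apply ..).symm }

lemma isDenseSieve_equalizer {c : Cone K} (hc : IsLimit c) (s : ∀ i, G.obj (K.obj i))
    (hs : s ∈ (K ⋙ G).sections)
    {T : Sheaf J (Type u)} {i j : I} (f : T ⟶ (K.obj i).unop) (g : T ⟶ (K.obj j).unop)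
    (hfg : f ≫ (c.π.app i).unop = g ≫ (c.π.app j).unop) :
    IsDenseSieve (Presheaf.equalizerSieve (F := G) (X := op T)
      (G.map f.op (s i)) (G.map g.op (s j))) := by
  have hT : f ≫ ((quotientCone s hs).π.app i).unop = g ≫ ((quotientCone s hs).π.app j).unop := by
    rw [← hc.fac (quotientCone s hs) i, ← hc.fac (quotientCone s hs) j]
    rw [unop_comp, unop_comp, ← Category.assoc, hfg, Category.assoc]
  rw [isDenseSieve_iff]
  intro d z
  have hz := ConcreteCategory.congr_hom (congr_app (congr_arg (·.hom) hT) (op d)) z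
  refine J.superset_covering ?_ (Presheaf.equalizerSieve_mem J
    (toSheafify J (quotientPresheaf s))
    ((toQuotientPresheaf s i).app (op d) (f.hom.app (op d) z))
    ((toQuotientPresheaf s j).app (op d) (g.hom.app (op d) z)) hz)
  intro d' h hh
  have := (toQuotientPresheaf_eq_iff s (c := d') ((K.obj i).unop.obj.map h.op (f.hom.app _ z))
    ((K.obj j).unop.obj.map h.op (g.hom.app _ z))).1 hh
  change G.map ((representedSheaf J).map h ≫ ofSection z).op _ =
    G.map ((representedSheaf J).map h ≫ ofSection z).op _
  rw [← map_comp_ofSection, ← map_comp_ofSection, ← ofSection_comp, ← ofSection_comp] at this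
  simpa using this

lemma isDenseSieve_of_isLimit {c : Cone K} (hc : IsLimit c) :
    IsDenseSieve (Sieve.ofArrows (X := c.pt.unop) (fun i ↦ (K.obj i).unop)
      fun i ↦ (c.π.app i).unop) := by
  refine .of_jointly_epi fun W a b h ↦ Quiver.Hom.op_inj (hc.hom_ext fun i ↦ ?_)
  exact Quiver.Hom.unop_inj (h _ (Sieve.ofArrows_mk _ _ i))

lemma preservesLimits_of_isSheaf_canonicalTopology
    (hG : Presieve.IsSheaf (canonicalTopology (Sheaf J (Type u))) G) :
    PreservesLimitsOfSize.{u, u} G where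
  preservesLimitsOfShape :=
    { preservesLimit :=
        { preserves := fun {c} hc ↦ by
            rw [Types.isLimit_iff]
            intro s hs
            have hS := hG _ ((mem_canonicalTopology_iff_isDenseSieve _).2
              (isDenseSieve_of_isLimit hc))
            rw [← Presieve.isSheafFor_iff_generate, Presieve.isSheafFor_arrows_iff] at hS
            refine hS s fun i j T f g hfg ↦ ?_
            exact (hG _ ((mem_canonicalTopology_iff_isDenseSieve _).2
              (isDenseSieve_equalizer hc s hs f g hfg))).isSeparatedFor.ext fun _ _ h ↦ h } }

end

end CategoryTheory.Sheaf
theorem statement8 {C : Type u} [SmallCategory C] (J : GrothendieckTopology C)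
    {D : Type v} [Category.{w} D] (F : (Sheaf J (Type u))ᵒᵖ ⥤ D) :
    Presheaf.IsSheaf (Sheaf.canonicalTopology (Sheaf J (Type u))) F ↔
      PreservesLimitsOfSize.{u, u} F := by
  refine ⟨fun h ↦ ⟨⟨⟨fun {c} hc ↦ ⟨coyonedaJointlyReflectsLimits _ _ fun X ↦ ?_⟩⟩⟩⟩,
    fun h X ↦ Sheaf.isSheaf_canonicalTopology_of_preservesLimits _⟩
  have := Sheaf.preservesLimits_of_isSheaf_canonicalTopology (h X.unop)
  exact isLimitOfPreserves (F ⋙ coyoneda.obj X) hc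
end

section
/- Let C be a small category with a subcanonical Grothendieck topology J, let D be a category with all u-small limits, and let F : Cᵒᵖ ⥤ D. Let F_* : (Sheaf J (Type u))ᵒᵖ ⥤ D be a pointwise right Kan extension of F along the opposite of the Yoneda embedding C ⥤ Sheaf J (Type u) (which is well-defined since J is subcanonical, so representable presheaves are sheaves). Then F is a J-sheaf (Presheaf.IsSheaf) if and only if F_* preserves all limits of u-small shape. -/
/-!
Statement 11: Let `C` be a small category with a subcanonical Grothendieck topology `J`,
`D` a category with all `u`-small limits, and `F : Cᵒᵖ ⥤ D`. Let `F_*` be a pointwise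
right Kan extension of `F` along the opposite of the Yoneda embedding
`C ⥤ Sheaf J (Type u)`. Then `F` is a `J`-sheaf iff `F_*` preserves all limits of
`u`-small shape.
-/

open CategoryTheory Limits

universe w v u

open Opposite

/-- If `L` is a left adjoint with fully faithful right adjoint, then `G` preserves colimits as soon
as `L ⋙ G` does. -/
lemma preservesColimitsOfShape_of_leftAdjoint_comp {A B E K : Type*} [Category* A] [Category* B]
    [Category* E] [Category* K] [HasColimitsOfShape K A] {L : A ⥤ B} {R : B ⥤ A} (adj : L ⊣ R)
    [R.Full] [R.Faithful] (G : B ⥤ E) [PreservesColimitsOfShape K (L ⋙ G)] :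
    PreservesColimitsOfShape K G where
  preservesColimit {P} := by
    have := adj.leftAdjoint_preservesColimits
    have : PreservesColimit ((P ⋙ R) ⋙ L) G :=
      preservesColimit_of_preserves_colimit_cocone
        (isColimitOfPreserves L (colimit.isColimit (P ⋙ R)))
        (isColimitOfPreserves (L ⋙ G) (colimit.isColimit (P ⋙ R)))
    exact preservesColimit_of_iso_diagram G
      (Functor.associator _ _ _ ≪≫ Functor.isoWhiskerLeft P (asIso adj.counit) ≪≫ P.rightUnitor)

lemma wEqualsLocallyBijective_type_max {C : Type u} [SmallCategory C]
    (J : GrothendieckTopology C) : J.WEqualsLocallyBijective (Type (max w u)) := by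
  have : EssentiallySmall.{max w u} C := (essentiallySmall_iff C).2 ⟨inferInstance, inferInstance⟩
  exact GrothendieckTopology.WEqualsLocallyBijective.ofEssentiallySmall J

instance preservesSheafification_uliftFunctor {C : Type u} [SmallCategory C]
    (J : GrothendieckTopology C) : J.PreservesSheafification uliftFunctor.{w, u} where
  le {P Q} f hf := by
    rw [GrothendieckTopology.W_iff_isLocallyBijective] at hf
    obtain ⟨h₁, h₂⟩ := hf
    have := wEqualsLocallyBijective_type_max.{w} J
    refine (J.W_iff_isLocallyBijective (A := Type (max w u)) _).2
      ⟨⟨fun {X} x y h ↦ ?_⟩, ⟨fun {X} s ↦ ?_⟩⟩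
    · refine J.superset_covering ?_
        (Presheaf.equalizerSieve_mem J f x.down y.down
          (show f.app X x.down = f.app X y.down from congr_arg ULift.down h))
      intro Y g hg
      exact congr_arg ULift.up hg
    · refine J.superset_covering ?_ (Presheaf.imageSieve_mem J f s.down)
      rintro Y g ⟨t, ht⟩
      exact ⟨ULift.up t, congr_arg ULift.up ht⟩

instance preservesColimits_sheafCompose_uliftFunctor {C : Type u} [SmallCategory C]
    (J : GrothendieckTopology C) :
    PreservesColimitsOfSize.{u, u} (sheafCompose J uliftFunctor.{w, u}) where
  preservesColimitsOfShape {K} _ := by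
    have : PreservesColimitsOfShape K
        (presheafToSheaf J (Type u) ⋙ sheafCompose J uliftFunctor.{w, u}) :=
      preservesColimitsOfShape_of_natIso
        (sheafComposeNatIso J uliftFunctor.{w, u}
          (sheafificationAdjunction J _) (sheafificationAdjunction J _))
    exact preservesColimitsOfShape_of_leftAdjoint_comp (sheafificationAdjunction J (Type u)) _

/-- Restricting a limit-preserving functor along the sheaf Yoneda embedding gives a sheaf: a
representable sheaf is the colimit of the representables indexed by any covering sieve. -/
lemma isSheaf_yoneda_op_comp {C : Type u} [SmallCategory C] (J : GrothendieckTopology C)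
    [J.Subcanonical] {D : Type v} [Category.{w} D] (G : (Sheaf J (Type u))ᵒᵖ ⥤ D)
    [PreservesLimitsOfSize.{u, u} G] : Presheaf.IsSheaf J (J.yoneda.op ⋙ G) := by
  rw [Presheaf.isSheaf_iff_isLimit]
  intro X S hS
  have hc : IsColimit (J.yoneda.mapCocone S.arrows.cocone) := by
    refine (Cocone.isColimitYonedaEquiv _).symm fun P ↦ ?_
    let e : J.yoneda.op ⋙ yoneda.obj P ≅ P.obj :=
      NatIso.ofComponents (fun X ↦ (J.yonedaEquiv (X := X.unop)).toIso) (fun {X Y} f ↦ by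
        ext g
        exact (J.yonedaEquiv_naturality g f.unop).symm)
    exact IsLimit.mapConeEquiv e.symm
      ((Presheaf.isSheaf_iff_isLimit J P.obj).1 P.property S hS).some
  exact ⟨isLimitOfPreserves G hc.op⟩

section

variable {C : Type u} [SmallCategory C] {J : GrothendieckTopology C}
    [J.Subcanonical] {D : Type v} [Category.{w} D]
    {F : Cᵒᵖ ⥤ D} {Fst : (Sheaf J (Type u))ᵒᵖ ⥤ D}
    {α : J.yoneda.op ⋙ Fst ⟶ F}

/-- Morphisms from `d` into the pointwise right Kan extension of `F` at `P` are natural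
transformations from `P` to `Hom(d, F(-))`, up to universe lifting. -/
noncomputable def homEquivOfIsPointwiseRightKanExtension
    (hpt : (Functor.RightExtension.mk Fst α).IsPointwiseRightKanExtension) (d : D)
    (P : Sheaf J (Type u)) :
    (d ⟶ Fst.obj (op P)) ≃
      (P.obj ⋙ uliftFunctor.{w} ⟶ F ⋙ coyoneda.obj (op d) ⋙ uliftFunctor.{u}) where
  toFun f :=
    { app X := TypeCat.ofHom fun x ↦
        ⟨f ≫ Fst.map (J.yonedaEquiv.symm x.down : J.yoneda.obj X.unop ⟶ P).op ≫ α.app X⟩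
      naturality X Y g := by
        have key (x : P.obj.obj X) :
            f ≫ Fst.map (J.yonedaEquiv.symm (P.obj.map g x)).op ≫ α.app Y =
              (f ≫ Fst.map (J.yonedaEquiv.symm x).op ≫ α.app X) ≫ F.map g := by
          have := α.naturality g
          dsimp at this
          rw [J.yonedaEquiv_symm_map, op_comp, Functor.map_comp, Category.assoc, this]
          simp only [Category.assoc]
        ext x
        exact congr_arg ULift.up (key x.down) }
  invFun τ := (hpt (op P)).lift
    { pt := d
      π :=
        { app g := (τ.app g.right ⟨J.yonedaEquiv g.hom.unop⟩).down
          naturality g₁ g₂ φ := by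
            have h : P.obj.map φ.right (J.yonedaEquiv g₁.hom.unop) =
                J.yonedaEquiv g₂.hom.unop := by
              rw [J.yonedaEquiv_naturality', ← StructuredArrow.w φ]
              rfl
            refine (Category.id_comp _).trans (Eq.trans ?_ (congr_arg ULift.down
              (NatTrans.naturality_apply τ φ.right ⟨J.yonedaEquiv g₁.hom.unop⟩)))
            exact congr_arg (fun y ↦ (τ.app g₂.right ⟨y⟩).down) h.symm } }
  left_inv f := (hpt (op P)).hom_ext fun g ↦ by
    refine ((hpt (op P)).fac _ g).trans ?_
    change f ≫ Fst.map (J.yonedaEquiv.symm (J.yonedaEquiv g.hom.unop)).op ≫ _ =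
      f ≫ Fst.map g.hom ≫ _
    rw [Equiv.symm_apply_apply]
    rfl
  right_inv τ := by
    ext X x
    refine congr_arg ULift.up (((hpt (op P)).fac _
      (StructuredArrow.mk (Y := X)
        (J.yonedaEquiv.symm x.down : J.yoneda.obj X.unop ⟶ P).op)).trans ?_)
    exact congr_arg (fun y ↦ (τ.app X ⟨y⟩).down) (J.yonedaEquiv.apply_symm_apply x.down)

/-- The presheaf `Hom(d, F_*(-))` is represented by the sheaf `Hom(d, F(-))`, up to universe
lifting. -/
noncomputable def isoOfIsPointwiseRightKanExtension
    (hpt : (Functor.RightExtension.mk Fst α).IsPointwiseRightKanExtension) (d : D)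
    (hF : Presheaf.IsSheaf J (F ⋙ coyoneda.obj (op d) ⋙ uliftFunctor.{u})) :
    Fst ⋙ coyoneda.obj (op d) ⋙ uliftFunctor.{u} ≅
      (sheafCompose J uliftFunctor.{w, u}).op ⋙ yoneda.obj ⟨_, hF⟩ :=
  NatIso.ofComponents (fun P ↦ (Equiv.ulift.trans
      ((homEquivOfIsPointwiseRightKanExtension hpt d P.unop).trans
        ((fullyFaithfulSheafToPresheaf J (Type (max u w))).homEquiv
          (X := (sheafCompose J uliftFunctor.{w, u}).obj P.unop) (Y := ⟨_, hF⟩)).symm)).toIso)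
    fun {P Q} g ↦ by
    have key (f : d ⟶ Fst.obj P) (X : Cᵒᵖ) (x : Q.unop.obj.obj X) :
        (f ≫ Fst.map g) ≫
            Fst.map (J.yonedaEquiv.symm x : J.yoneda.obj X.unop ⟶ Q.unop).op ≫ α.app X =
          f ≫ Fst.map (J.yonedaEquiv.symm (g.unop.hom.app X x) : J.yoneda.obj X.unop ⟶ P.unop).op ≫
            α.app X := by
      have := J.yonedaEquiv_symm_naturality_right X.unop g.unop x
      erw [← this]
      simp
    ext f
    apply Sheaf.hom_ext
    ext X x
    exact congr_arg ULift.up (key f.down X x.down)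

lemma preservesLimitsOfSize_of_isSheaf
    (hpt : (Functor.RightExtension.mk Fst α).IsPointwiseRightKanExtension)
    (hF : Presheaf.IsSheaf J F) :
    PreservesLimitsOfSize.{u, u} Fst where
  preservesLimitsOfShape {K} _ :=
    { preservesLimit {_} :=
        { preserves {_} hc := ⟨coyonedaJointlyReflectsLimits _ _ fun d ↦ by
            have hd : Presheaf.IsSheaf J (F ⋙ coyoneda.obj (op d.unop) ⋙ uliftFunctor.{u}) :=
              (isSheaf_iff_isSheaf_of_type _ _).2
                (Presieve.isSheaf_comp_uliftFunctor J (hF d.unop))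
            have : PreservesLimitsOfShape K (sheafCompose J uliftFunctor.{w, u}).op :=
              preservesLimitsOfShape_op K _
            have : PreservesLimitsOfShape K ((Fst ⋙ coyoneda.obj d) ⋙ uliftFunctor.{u}) :=
              preservesLimitsOfShape_of_natIso
                (isoOfIsPointwiseRightKanExtension hpt d.unop hd).symm
            have := preservesLimitsOfShape_of_reflects_of_preserves (J := K)
              (Fst ⋙ coyoneda.obj d) uliftFunctor.{u}
            exact isLimitOfPreserves (Fst ⋙ coyoneda.obj d) hc⟩ } }

end

theorem statement11 {C : Type u} [SmallCategory C] (J : GrothendieckTopology C)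
    [J.Subcanonical] {D : Type v} [Category.{w} D] [HasLimitsOfSize.{u, u} D]
    (F : Cᵒᵖ ⥤ D) (Fst : (Sheaf J (Type u))ᵒᵖ ⥤ D)
    (α : J.yoneda.op ⋙ Fst ⟶ F)
    (hpt : (Functor.RightExtension.mk Fst α).IsPointwiseRightKanExtension) :
    Presheaf.IsSheaf J F ↔ PreservesLimitsOfSize.{u, u} Fst := by
  have := hpt.isIso_hom
  have : IsIso α := this
  refine ⟨fun hF ↦ preservesLimitsOfSize_of_isSheaf hpt hF, fun _ ↦ ?_⟩
  exact (Presheaf.isSheaf_of_iso_iff (asIso α)).1 (isSheaf_yoneda_op_comp J Fst)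
end
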